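/- Lyapunov decrease for the attitude controller on SO(3): let R_d ∈ SO(3) be fixed, k > 0, and let R : [0,∞) → ℝ^{3×3} be differentiable with R(t) ∈ SO(3) for all t and satisfying the closed-loop kinematics R′(t) = −k · R(t) · skew(R_dᵀ R(t)) (i.e., the body-frame kinematics R′ = R S(ω) with feedback ω = −k (skew(R_dᵀR))∨). Then the function V(t) := ½ ‖R(t) − R_d‖_F² satisfies V′(t) = −k ‖skew(R_dᵀ R(t))‖_F² ≤ 0 for all t ≥ 0; in particular V is nonincreasing. -/

import Mathlib

open Matrix

attribute [local instance] Matrix.normedAddCommGroup Matrix.normedSpace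

/-- The skew-symmetric part `skew(A) = ½(A − Aᵀ)` of a `3 × 3` matrix. -/
noncomputable def skewPart (A : Matrix (Fin 3) (Fin 3) ℝ) : Matrix (Fin 3) (Fin 3) ℝ :=
  (1/2 : ℝ) • (A - Aᵀ)

/-- Along a differentiable curve of matrices, the derivative of `½‖A‖_F²` is the Frobenius inner
product of `A` with its derivative. -/
theorem hasDerivAt_half_trace_transpose_mul_self {m n : Type*} [Fintype m] [Fintype n]
    {A : ℝ → Matrix m n ℝ} {A' : Matrix m n ℝ} {t : ℝ} (hA : HasDerivAt A A' t) :
    HasDerivAt (fun s => (1/2 : ℝ) * trace ((A s)ᵀ * A s)) (trace ((A t)ᵀ * A')) t := by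
  have entry (i : m) (j : n) : HasDerivAt (fun s => A s i j) (A' i j) t :=
    hasDerivAt_pi.1 (hasDerivAt_pi.1 hA i) j
  simp only [trace, diag_apply, mul_apply, transpose_apply]
  have sum_entries := (HasDerivAt.fun_sum (u := Finset.univ) fun j _ =>
    HasDerivAt.fun_sum (u := Finset.univ) fun i _ => (entry i j).mul (entry i j)).const_mul (1/2 : ℝ)
  refine sum_entries.congr_deriv ?_
  simp only [Finset.mul_sum]
  refine Finset.sum_congr rfl fun j _ => Finset.sum_congr rfl fun i _ => ?_
  ring

theorem trace_transpose_mul_self_nonneg {m n : Type*} [Fintype m] [Fintype n]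
    (A : Matrix m n ℝ) : 0 ≤ trace (Aᵀ * A) := by
  simp only [trace, diag_apply, mul_apply, transpose_apply]
  exact Finset.sum_nonneg fun j _ => Finset.sum_nonneg fun i _ => mul_self_nonneg _

theorem trace_skewPart (A : Matrix (Fin 3) (Fin 3) ℝ) : trace (skewPart A) = 0 := by
  simp [skewPart]

theorem trace_mul_skewPart (A : Matrix (Fin 3) (Fin 3) ℝ) :
    trace (A * skewPart A) = -trace ((skewPart A)ᵀ * skewPart A) := by
  simp only [skewPart, trace_fin_three, mul_apply, Fin.sum_univ_three, transpose_apply,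
    Matrix.smul_apply, Matrix.sub_apply, smul_eq_mul]
  ring

/-- Lyapunov decrease for the attitude controller on `SO(3)`: along the closed-loop
kinematics `R′ = −k R skew(R_dᵀ R)`, the function `V = ½‖R − R_d‖_F²`
(written via `‖A‖_F² = trace (Aᵀ A)`) satisfies
`V′ = −k ‖skew(R_dᵀ R)‖_F² ≤ 0`; in particular `V` is nonincreasing on `[0, ∞)`. -/
theorem attitude_lyapunov_decrease
    (Rd : Matrix (Fin 3) (Fin 3) ℝ) (hRd : Rdᵀ * Rd = 1 ∧ Rd.det = 1)
    (k : ℝ) (hk : 0 < k)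
    (R : ℝ → Matrix (Fin 3) (Fin 3) ℝ)
    (hSO : ∀ t : ℝ, 0 ≤ t → (R t)ᵀ * R t = 1 ∧ (R t).det = 1)
    (hdyn : ∀ t : ℝ, 0 ≤ t →
      HasDerivAt R (-k • (R t * skewPart (Rdᵀ * R t))) t)
    (V : ℝ → ℝ)
    (hV : V = fun t : ℝ => (1/2 : ℝ) * Matrix.trace ((R t - Rd)ᵀ * (R t - Rd))) :
    (∀ t : ℝ, 0 ≤ t →
      HasDerivAt V
        (-k * Matrix.trace ((skewPart (Rdᵀ * R t))ᵀ * skewPart (Rdᵀ * R t))) t ∧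
      -k * Matrix.trace ((skewPart (Rdᵀ * R t))ᵀ * skewPart (Rdᵀ * R t)) ≤ 0) ∧
    AntitoneOn V (Set.Ici 0) := by
  have deriv_V : ∀ t : ℝ, 0 ≤ t → HasDerivAt V
      (-k * trace ((skewPart (Rdᵀ * R t))ᵀ * skewPart (Rdᵀ * R t))) t := by
    intro t ht
    rw [hV]
    refine (hasDerivAt_half_trace_transpose_mul_self ((hdyn t ht).sub_const Rd)).congr_deriv ?_
    rw [mul_smul_comm, trace_smul, smul_eq_mul, transpose_sub, sub_mul, ← Matrix.mul_assoc,
      ← Matrix.mul_assoc, (hSO t ht).1, Matrix.one_mul, trace_sub, trace_skewPart,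
      trace_mul_skewPart, zero_sub, neg_neg]
  have deriv_nonpos (t : ℝ) :
      -k * trace ((skewPart (Rdᵀ * R t))ᵀ * skewPart (Rdᵀ * R t)) ≤ 0 :=
    mul_nonpos_of_nonpos_of_nonneg (neg_nonpos.2 hk.le) (trace_transpose_mul_self_nonneg _)
  refine ⟨fun t ht => ⟨deriv_V t ht, deriv_nonpos t⟩, ?_⟩
  refine antitoneOn_of_hasDerivWithinAt_nonpos (convex_Ici 0)
    (fun t ht => (deriv_V t ht).continuousAt.continuousWithinAt)
    (fun t ht => (deriv_V t (interior_subset ht)).hasDerivWithinAt) fun t _ => deriv_nonpos t
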